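/- Let R be a commutative ring, m an odd positive integer, T an m×m skew-symmetric matrix over R with zeros on the diagonal, z₁,z₂,z₃ ∈ R, and c_{i,j,l} ∈ R with T_{j,i} = Σ_{l=1}^{3} c_{i,j,l} z_l for all i,j. Then for every i ∈ {1,…,m}: Σ_{r=1}^{m} T_{r,i} · ( Σ_{h=1, h≠i}^{m} σ_{i,r,h} pf_{î,r̂,ĥ}(T) c_{h,i,2} ) + z₁ d^i_{1,2} = z₃ d^i_{2,3}. (This identity verifies the product G₁ⁱ·F₂ in the full DG algebra structure on the resolution of the trimmed ideal.) -/

import Mathlib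

open Finset

/-- The unit step (Heaviside) function on the integers. -/
def theta (x : ℤ) : ℕ := if 0 < x then 1 else 0

/-- `σ_{i,j,r}` for (1-based) labels `i j r`. -/
def sigma3 (i j r : ℕ) : ℤ :=
  if i ≠ j ∧ i ≠ r ∧ j ≠ r then
    (-1) ^ (i + j + r + 1 + theta ((r : ℤ) - (i : ℤ)) + theta ((r : ℤ) - (j : ℤ)) +
      theta ((j : ℤ) - (i : ℤ)))
  else 0

/-- `σ_{i,j,r,h,k}` for (1-based) labels. -/
def sigma5 (i j r h k : ℕ) : ℤ :=
  if i ≠ j ∧ i ≠ r ∧ i ≠ h ∧ i ≠ k ∧ j ≠ r ∧ j ≠ h ∧ j ≠ k ∧ r ≠ h ∧ r ≠ k ∧ h ≠ k then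
    (-1) ^ (h + k + 1 + theta ((k : ℤ) - (i : ℤ)) + theta ((k : ℤ) - (j : ℤ)) +
      theta ((k : ℤ) - (r : ℤ)) + theta ((k : ℤ) - (h : ℤ)) + theta ((h : ℤ) - (i : ℤ)) +
      theta ((h : ℤ) - (j : ℤ)) + theta ((h : ℤ) - (r : ℤ)))
  else 0

/-- The successor of `i` in `Fin N` (with wraparound, which is irrelevant in our uses). -/
def finNext {N : ℕ} (i : Fin N) : Fin N :=
  ⟨(i.1 + 1) % N, Nat.mod_lt _ (Nat.lt_of_le_of_lt (Nat.zero_le _) i.2)⟩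

/-- The pfaffian of an `N × N` matrix, as the sum over all partitions of `Fin N` into
two-element blocks (encoded by the permutations `σ` with `σ 0 < σ 1`, `σ 2 < σ 3`, …,
`σ 0 < σ 2 < σ 4 < ⋯`) of the sign of the permutation times the product of the entries
of `M` at the blocks.  It is `0` when `N` is odd and `1` when `N = 0`. -/
noncomputable def pfAux {R : Type*} [CommRing R] {N : ℕ} (M : Matrix (Fin N) (Fin N) R) : R :=
  if N % 2 = 0 then
    ∑ σ ∈ Finset.univ.filter (fun σ : Equiv.Perm (Fin N) =>
        (∀ i : Fin N, (i : ℕ) % 2 = 0 → σ i < σ (finNext i)) ∧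
        (∀ i j : Fin N, (i : ℕ) % 2 = 0 → (j : ℕ) % 2 = 0 → i < j → σ i < σ j)),
      ((Equiv.Perm.sign σ : ℤ) : R) *
        ∏ i ∈ Finset.univ.filter (fun i : Fin N => (i : ℕ) % 2 = 0), M (σ i) (σ (finNext i))
  else 0

/-- The pfaffian of the submatrix of `T` on the rows and columns indexed by the finset `S`
(taken in increasing order). -/
noncomputable def pfSub {R : Type*} [CommRing R] {m : ℕ} (T : Matrix (Fin m) (Fin m) R)
    (S : Finset (Fin m)) : R :=
  pfAux (fun a b : Fin S.card => T ((S.orderIsoOfFin rfl a : Fin m)) ((S.orderIsoOfFin rfl b : Fin m)))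

/-- `pfDel T l` is the pfaffian of the submatrix of `T` obtained by deleting the rows and
columns indexed by the list `l`, set to `0` if `l` has a repeated entry. -/
noncomputable def pfDel {R : Type*} [CommRing R] {m : ℕ} (T : Matrix (Fin m) (Fin m) R)
    (l : List (Fin m)) : R :=
  if l.Nodup then pfSub T (Finset.univ \ l.toFinset) else 0

/-- `y_i := (−1)^{i+1} pf_{î}(T)` (1-based label `i + 1` for `i : Fin m`). -/
noncomputable def yPf {R : Type*} [CommRing R] {m : ℕ} (T : Matrix (Fin m) (Fin m) R)
    (i : Fin m) : R :=
  (-1 : R) ^ (((i : ℕ) + 1) + 1) * pfDel T [i]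

/-- `d^k_{α,β} := Σ_i Σ_r σ_{i,k,r} c_{i,k,β} c_{r,k,α} pf_{î,k̂,r̂}(T)`, where the last
index of `c` is 0-based (`0,1,2` standing for `1,2,3`). -/
noncomputable def dTop {R : Type*} [CommRing R] {m : ℕ} (T : Matrix (Fin m) (Fin m) R)
    (c : Fin m → Fin m → Fin 3 → R) (k : Fin m) (α β : Fin 3) : R :=
  ∑ i : Fin m, ∑ r : Fin m,
    ((sigma3 ((i : ℕ) + 1) ((k : ℕ) + 1) ((r : ℕ) + 1) : ℤ) : R) *
      c i k β * c r k α * pfDel T [i, k, r]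

/-- `d^{k,i,j}_{α,β} := Σ_r σ_{i,j,r} Σ_h σ_{i,j,r,h,k} pf_{î,ĵ,r̂,ĥ,k̂}(T) c_{r,k,β} c_{h,k,α}`,
where the last index of `c` is 0-based (`0,1,2` standing for `1,2,3`). -/
noncomputable def dTop3 {R : Type*} [CommRing R] {m : ℕ} (T : Matrix (Fin m) (Fin m) R)
    (c : Fin m → Fin m → Fin 3 → R) (k i j : Fin m) (α β : Fin 3) : R :=
  ∑ r : Fin m, ((sigma3 ((i : ℕ) + 1) ((j : ℕ) + 1) ((r : ℕ) + 1) : ℤ) : R) *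
    ∑ h : Fin m,
      ((sigma5 ((i : ℕ) + 1) ((j : ℕ) + 1) ((r : ℕ) + 1) ((h : ℕ) + 1) ((k : ℕ) + 1) : ℤ) : R) *
        pfDel T [i, j, r, h, k] * c r k β * c h k α

theorem sigma3_swap_right (i j r : ℕ) : sigma3 i r j = -sigma3 i j r := by
  unfold sigma3 theta
  by_cases h : i ≠ j ∧ i ≠ r ∧ j ≠ r
  · have h' : i ≠ r ∧ i ≠ j ∧ r ≠ j := ⟨h.2.1, h.1, h.2.2.symm⟩
    rw [if_pos h, if_pos h', show i + r + j = i + j + r by ring]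
    obtain ⟨h1, h2, h3⟩ := h
    rcases lt_or_gt_of_ne h3 with h3 | h3
    · rw [if_neg (show ¬ 0 < (j : ℤ) - r by omega), if_pos (show 0 < (r : ℤ) - j by omega)]
      ring
    · rw [if_pos (show 0 < (j : ℤ) - r by omega), if_neg (show ¬ 0 < (r : ℤ) - j by omega)]
      ring
  · rw [if_neg h, if_neg (by tauto), neg_zero]

theorem sigma3_swap_left (i j r : ℕ) : sigma3 j i r = -sigma3 i j r := by
  unfold sigma3 theta
  by_cases h : i ≠ j ∧ i ≠ r ∧ j ≠ r
  · have h' : j ≠ i ∧ j ≠ r ∧ i ≠ r := ⟨h.1.symm, h.2.2, h.2.1⟩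
    rw [if_pos h, if_pos h', show j + i + r = i + j + r by ring]
    obtain ⟨h1, h2, h3⟩ := h
    rcases lt_or_gt_of_ne h1 with h1 | h1
    · rw [if_neg (show ¬ 0 < (i : ℤ) - j by omega), if_pos (show 0 < (j : ℤ) - i by omega)]
      ring
    · rw [if_pos (show 0 < (i : ℤ) - j by omega), if_neg (show ¬ 0 < (j : ℤ) - i by omega)]
      ring
  · rw [if_neg h, if_neg (by tauto), neg_zero]

theorem sigma3_self_right (i j : ℕ) : sigma3 i j j = 0 := by simp [sigma3]

theorem sigma3_self_outer (i j : ℕ) : sigma3 i j i = 0 := by simp [sigma3]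

theorem pfDel_perm {R : Type*} [CommRing R] {m : ℕ} (T : Matrix (Fin m) (Fin m) R)
    {l l' : List (Fin m)} (h : l.Perm l') : pfDel T l = pfDel T l' := by
  unfold pfDel
  rw [List.toFinset_eq_of_perm _ _ h]
  simp only [h.nodup_iff]

/-- An alternating bilinear form vanishes on equal arguments. -/
theorem sum_sum_alternating_eq_zero {ι R : Type*} [CommRing R] [Fintype ι] (G : ι → ι → R)
    (hG : ∀ r h, G h r = -G r h) (hG' : ∀ r, G r r = 0) (x : ι → R) :
    ∑ r, ∑ h, G r h * x r * x h = 0 := by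
  rw [← Fintype.sum_prod_type']
  refine Finset.sum_involution (fun p _ => p.swap) ?_ ?_ ?_ ?_
  · rintro ⟨a, b⟩ -
    simp only [Prod.swap, hG a b]
    ring
  · rintro ⟨a, b⟩ - hne heq
    obtain rfl : b = a := congrArg Prod.fst heq
    exact hne (by simp [hG'])
  · simp
  · simp

theorem dTop_eq {R : Type*} [CommRing R] {m : ℕ} (T : Matrix (Fin m) (Fin m) R)
    (c : Fin m → Fin m → Fin 3 → R) (k : Fin m) (α β : Fin 3) :
    dTop T c k α β = -∑ i : Fin m, ∑ r : Fin m,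
      (((sigma3 ((k : ℕ) + 1) ((i : ℕ) + 1) ((r : ℕ) + 1) : ℤ) : R) * pfDel T [k, i, r]) *
        c i k β * c r k α := by
  simp only [dTop, ← Finset.sum_neg_distrib]
  refine Finset.sum_congr rfl fun i _ => Finset.sum_congr rfl fun r _ => ?_
  rw [sigma3_swap_left ((k : ℕ) + 1), pfDel_perm T (List.Perm.swap k i [r])]
  push_cast
  ring

/-- The identity verifying the product `G₁ⁱ·F₂` in the full DG algebra structure on the
resolution of the trimmed ideal: with `T_{j,i} = Σ_l c_{i,j,l} z_l` (subscripts of `z` and the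
last index of `c` encoded 0-based by `Fin 3`), for every `i`:
`Σ_r T_{r,i}·(Σ_{h≠i} σ_{i,r,h} pf_{î,r̂,ĥ}(T) c_{h,i,2}) + z₁ d^i_{1,2} = z₃ d^i_{2,3}`. -/
theorem trimming_res_productI_coeff {R : Type*} [CommRing R] (m : ℕ) (hodd : Odd m)
    (hpos : 0 < m) (T : Matrix (Fin m) (Fin m) R)
    (hskew : ∀ a b, T b a = - T a b) (hdiag : ∀ a, T a a = 0)
    (z : Fin 3 → R) (c : Fin m → Fin m → Fin 3 → R)
    (hc : ∀ i j : Fin m, T j i = ∑ l : Fin 3, c i j l * z l) (i : Fin m) :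
    ∑ r : Fin m, T r i *
        (∑ h ∈ Finset.univ.filter (fun h : Fin m => h ≠ i),
          ((sigma3 ((i : ℕ) + 1) ((r : ℕ) + 1) ((h : ℕ) + 1) : ℤ) : R) *
            pfDel T [i, r, h] * c h i 1)
      + z 0 * dTop T c i 0 1 = z 2 * dTop T c i 1 2 := by
  set G : Fin m → Fin m → R := fun r h =>
    ((sigma3 ((i : ℕ) + 1) ((r : ℕ) + 1) ((h : ℕ) + 1) : ℤ) : R) * pfDel T [i, r, h] with hGdef
  have hG : ∀ r h, G h r = -G r h := fun r h => by
    simp only [hGdef]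
    rw [sigma3_swap_right, pfDel_perm T ((List.Perm.swap r h []).cons i)]
    push_cast
    ring
  have hG' : ∀ r, G r r = 0 := fun r => by simp [hGdef, sigma3_self_right]
  have hfilter : ∀ r : Fin m, (∑ h ∈ Finset.univ.filter (fun h : Fin m => h ≠ i),
      ((sigma3 ((i : ℕ) + 1) ((r : ℕ) + 1) ((h : ℕ) + 1) : ℤ) : R) *
        pfDel T [i, r, h] * c h i 1) = ∑ h, G r h * c h i 1 := fun r => by
    refine Finset.sum_subset (Finset.filter_subset _ _) fun h _ hh => ?_
    obtain rfl : h = i := by simpa using hh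
    simp [sigma3_self_outer]
  have hT : ∀ r : Fin m, T r i = -(c r i 0 * z 0 + c r i 1 * z 1 + c r i 2 * z 2) := fun r => by
    rw [hskew i r, hc r i, Fin.sum_univ_three]
  have hd : dTop T c i 0 1 = ∑ r, ∑ h, G r h * c r i 0 * c h i 1 := by
    rw [dTop_eq, Finset.sum_comm, ← Finset.sum_neg_distrib]
    refine Finset.sum_congr rfl fun r _ => ?_
    rw [← Finset.sum_neg_distrib]
    refine Finset.sum_congr rfl fun h _ => ?_
    change -(G h r * c h i 1 * c r i 0) = _
    rw [hG r h]
    ring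
  have hd' : dTop T c i 1 2 = -∑ r, ∑ h, G r h * c r i 2 * c h i 1 := dTop_eq T c i 1 2
  have hsum : ∑ r, T r i * ∑ h, G r h * c h i 1 =
      -(z 0 * ∑ r, ∑ h, G r h * c r i 0 * c h i 1 + z 1 * ∑ r, ∑ h, G r h * c r i 1 * c h i 1 +
        z 2 * ∑ r, ∑ h, G r h * c r i 2 * c h i 1) := by
    simp only [Finset.mul_sum, ← Finset.sum_add_distrib, ← Finset.sum_neg_distrib]
    refine Finset.sum_congr rfl fun r _ => Finset.sum_congr rfl fun h _ => ?_
    rw [hT r]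
    ring
  simp only [hfilter]
  rw [hsum, hd, hd', sum_sum_alternating_eq_zero G hG hG' fun r => c r i 1]
  ring
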